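/- Assume the B-free subshift satisfies X_η = X_B. Then (X_η, S) satisfies the Garden of Eden theorem: a cellular automaton τ on (X_η, S) is surjective if and only if it is pre-injective. Moreover, every CA τ on (X_η, S) satisfies τ(x) ≤ S^t x coordinatewise for some t ∈ ℤ and all x ∈ X_η, and every surjective CA equals a power S^t of the shift. -/

import Mathlib

open Filter Set

noncomputable section

/-- The shift by `t`: `(shiftPow t x) n = x (n + t)`, i.e. `S^t`. -/
def shiftPow (t : ℤ) (x : ℤ → Bool) : ℤ → Bool := fun n => x (n + t)

/-- The left shift `S`, `(S x) n = x (n + 1)`. -/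
def shift : (ℤ → Bool) → (ℤ → Bool) := shiftPow 1

/-- The support of a `0-1`-sequence. -/
def supp (x : ℤ → Bool) : Set ℤ := {n | x n = true}

/-- The all-zero sequence `0^ℤ`. -/
def zeroSeq : ℤ → Bool := fun _ => false

/-- The all-one sequence `1^ℤ`. -/
def oneSeq : ℤ → Bool := fun _ => true

/-- The sequence `u = 0^{-ℕ} 1 0^{ℕ}` with a single `1` at position `0`. -/
def uSeq : ℤ → Bool := fun n => if n = 0 then true else false

/-- The set `F_B ⊆ ℤ` of `B`-free integers. -/
def BFreeSet (B : Set ℕ) : Set ℤ := {n | ∀ b ∈ B, ¬ ((b : ℤ) ∣ n)}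

open Classical in
/-- `η`, the indicator function of the `B`-free integers. -/
noncomputable def eta (B : Set ℕ) : ℤ → Bool := fun n => if n ∈ BFreeSet B then true else false

/-- The `B`-free subshift `X_η`: the orbit closure of `η` under the shift. -/
def Xeta (B : Set ℕ) : Set (ℤ → Bool) := closure {x | ∃ t : ℤ, x = shiftPow t (eta B)}

/-- A set `A ⊆ ℤ` is `B`-admissible if for every `b ∈ B` some residue class
mod `b` is disjoint from `A`. -/
def IsBAdmissible (B : Set ℕ) (A : Set ℤ) : Prop :=
  ∀ b ∈ B, ∃ r : ℤ, ∀ a ∈ A, ¬ ((b : ℤ) ∣ (a - r))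

/-- The `B`-admissible subshift `X_B`. -/
def XB (B : Set ℕ) : Set (ℤ → Bool) := {x | IsBAdmissible B (supp x)}

/-- `B` is primitive: no element divides a different element. -/
def Primitive (B : Set ℕ) : Prop := ∀ a ∈ B, ∀ b ∈ B, a ∣ b → a = b

/-- `B` is an Erdős set: infinite, `1 ∉ B` (elements positive), primitive, pairwise
coprime and thin. -/
def IsErdos (B : Set ℕ) : Prop :=
  B.Infinite ∧ (∀ b ∈ B, 2 ≤ b) ∧ Primitive B ∧
    (∀ a ∈ B, ∀ b ∈ B, a ≠ b → Nat.Coprime a b) ∧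
    Summable (fun b : B => (1 : ℝ) / (b : ℝ))

/-- A cellular automaton on `X`: a continuous self-map of `X` commuting with the shift. -/
def IsCA (X : Set (ℤ → Bool)) (τ : (ℤ → Bool) → (ℤ → Bool)) : Prop :=
  Set.MapsTo τ X X ∧ ContinuousOn τ X ∧ ∀ x ∈ X, τ (shift x) = shift (τ x)

/-- Pre-injectivity of a CA on `X`. -/
def PreInjective (X : Set (ℤ → Bool)) (τ : (ℤ → Bool) → (ℤ → Bool)) : Prop :=
  ∀ x ∈ X, ∀ y ∈ X, τ x = τ y → {n : ℤ | x n ≠ y n}.Finite → x = y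

/-- `X` is hereditary. -/
def Hereditary (X : Set (ℤ → Bool)) : Prop :=
  ∀ x ∈ X, ∀ y : ℤ → Bool, (∀ n, y n ≤ x n) → y ∈ X

/-- The hereditary closure `X̃` of a set `X`. -/
def heredClosure (X : Set (ℤ → Bool)) : Set (ℤ → Bool) :=
  {y | ∃ x ∈ X, ∀ n, y n ≤ x n}

/-- `X` is a subshift: nonempty, closed and shift-invariant. -/
def IsSubshift (X : Set (ℤ → Bool)) : Prop :=
  X.Nonempty ∧ IsClosed X ∧ shift '' X = X

/-- `τ` is given by a (sliding block) code of radius `ℓ` on `X`. -/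
def HasRadius (X : Set (ℤ → Bool)) (τ : (ℤ → Bool) → (ℤ → Bool)) (ℓ : ℕ) : Prop :=
  ∀ x ∈ X, ∀ y ∈ X, ∀ n : ℤ,
    (∀ i : ℤ, n - ℓ ≤ i → i ≤ n + ℓ → x i = y i) → τ x n = τ y n

open Classical in
/-- `A ⊆ ℤ` has logarithmic density `d`. -/
noncomputable def HasLogDensity (A : Set ℤ) (d : ℝ) : Prop :=
  Tendsto (fun N : ℕ =>
      (Real.log N)⁻¹ * ∑ n ∈ Finset.Icc 1 N, (if (n : ℤ) ∈ A then (1 : ℝ) / (n : ℝ) else 0))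
    atTop (nhds d)

/-- `B` is taut: removing any `b ∈ B` strictly increases the logarithmic density of the
`B`-free integers. -/
def IsTaut (B : Set ℕ) : Prop :=
  ∀ b ∈ B, ∀ d d' : ℝ,
    HasLogDensity (BFreeSet B) d → HasLogDensity (BFreeSet (B \ {b})) d' → d < d'

/-- `x` and `y` are proximal: along some sequence `r k → ∞`, the shifted sequences
`S^{r k} x` and `S^{r k} y` agree on arbitrarily large central windows, i.e.
`d(S^{r k} x, S^{r k} y) → 0` in the product topology. -/
def ProximalPair (x y : ℤ → Bool) : Prop :=
  ∃ r : ℕ → ℤ, Tendsto r atTop atTop ∧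
    ∀ m : ℕ, ∀ᶠ k in atTop, ∀ n : ℤ, |n| ≤ (m : ℤ) →
      shiftPow (r k) x n = shiftPow (r k) y n

/-- A subshift is proximal if every pair of its points is proximal. -/
def IsProximalSubshift (X : Set (ℤ → Bool)) : Prop :=
  ∀ x ∈ X, ∀ y ∈ X, ProximalPair x y

end

section Admissible

variable {B : Set ℕ}

lemma IsBAdmissible.mono {A A' : Set ℤ} (h : IsBAdmissible B A') (hA : A ⊆ A') :
    IsBAdmissible B A := fun b hb =>
  let ⟨r, hr⟩ := h b hb
  ⟨r, fun a ha => hr a (hA ha)⟩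

lemma exists_residue_of_card_lt (F : Finset ℤ) {c : ℕ} (hc : F.card < c) :
    ∃ r : ℤ, ∀ a ∈ F, ¬ ((c : ℤ) ∣ (a - r)) := by
  classical
  have : NeZero c := ⟨by omega⟩
  have hlt : (F.image (fun a : ℤ => (a : ZMod c))).card < (Finset.univ : Finset (ZMod c)).card := by
    rw [Finset.card_univ, ZMod.card]
    exact Finset.card_image_le.trans_lt hc
  obtain ⟨z, -, hz⟩ := Finset.exists_mem_notMem_of_card_lt_card hlt
  refine ⟨(z.val : ℤ), fun a ha hd => hz ?_⟩
  rw [← ZMod.intCast_zmod_eq_zero_iff_dvd] at hd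
  refine Finset.mem_image.2 ⟨a, ha, ?_⟩
  push_cast at hd
  rw [ZMod.natCast_zmod_val] at hd
  exact sub_eq_zero.1 hd

lemma isBAdmissible_of_small (F : Finset ℤ)
    (h : ∀ b ∈ B, b ≤ F.card → ∃ r : ℤ, ∀ a ∈ F, ¬ ((b : ℤ) ∣ (a - r))) :
    IsBAdmissible B (F : Set ℤ) := fun b hb => by
  rcases le_or_gt b F.card with hle | hlt
  · exact h b hb hle
  · exact exists_residue_of_card_lt F hlt

lemma shiftPow_shiftPow (s t : ℤ) (x : ℤ → Bool) :
    shiftPow s (shiftPow t x) = shiftPow (s + t) x := by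
  funext n
  simp only [shiftPow, add_assoc]

lemma shiftPow_zero (x : ℤ → Bool) : shiftPow 0 x = x := by
  funext n
  simp only [shiftPow, add_zero]

lemma shiftPow_mem_XB {x : ℤ → Bool} (hx : x ∈ XB B) (t : ℤ) : shiftPow t x ∈ XB B := by
  intro b hb
  obtain ⟨r, hr⟩ := hx b hb
  refine ⟨r - t, fun a ha => ?_⟩
  have := hr (a + t) ha
  rwa [show a + t - r = a - (r - t) by ring] at this

open Classical in
/-- The `0-1`-sequence with support `A`. -/
noncomputable def indicatorSeq (A : Set ℤ) : ℤ → Bool := fun n => decide (n ∈ A)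

lemma indicatorSeq_eq_true {A : Set ℤ} {n : ℤ} : indicatorSeq A n = true ↔ n ∈ A := by
  simp [indicatorSeq]

lemma supp_indicatorSeq (A : Set ℤ) : supp (indicatorSeq A) = A := by
  ext n
  simp [supp, indicatorSeq_eq_true]

lemma indicatorSeq_mem_XB {A : Set ℤ} : indicatorSeq A ∈ XB B ↔ IsBAdmissible B A := by
  simp [XB, supp_indicatorSeq]

lemma exists_eta_eq_of_mem_Xeta {x : ℤ → Bool} (hx : x ∈ Xeta B) (F : Finset ℤ) :
    ∃ t : ℤ, ∀ a ∈ F, eta B (a + t) = x a := by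
  have hU : IsOpen ((F : Set ℤ).pi fun a => ({x a} : Set Bool)) :=
    isOpen_set_pi F.finite_toSet fun _ _ => isOpen_discrete _
  obtain ⟨y, hy, t, rfl⟩ := mem_closure_iff.1 hx _ hU (fun a _ => rfl)
  exact ⟨t, fun a ha => hy a ha⟩

lemma eta_eq_true {n : ℤ} : eta B n = true ↔ n ∈ BFreeSet B := by
  simp [eta]

lemma infinite_of_Xeta_eq_XB (hBpos : ∀ b ∈ B, 2 ≤ b) (heq : Xeta B = XB B) : B.Infinite := by
  intro hfin
  have h0 : indicatorSeq ∅ ∈ Xeta B := by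
    rw [heq, indicatorSeq_mem_XB]
    exact fun b _ => ⟨0, fun a ha => ha.elim⟩
  set N : ℤ := ∏ b ∈ hfin.toFinset, (b : ℤ) with hN
  have hNpos : 0 < N := Finset.prod_pos fun b hb => by
    have := hBpos b (hfin.mem_toFinset.1 hb)
    omega
  obtain ⟨t, ht⟩ := exists_eta_eq_of_mem_Xeta h0 (Finset.Ico 0 N)
  have h1 := ht ((1 - t) % N)
    (Finset.mem_Ico.2 ⟨Int.emod_nonneg _ hNpos.ne', Int.emod_lt_of_pos _ hNpos⟩)
  have h2 : (1 - t) % N + t ∈ BFreeSet B := by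
    intro b hb hd
    have hbN : (b : ℤ) ∣ N := Finset.dvd_prod_of_mem _ (hfin.mem_toFinset.2 hb)
    have h3 : (b : ℤ) ∣ (1 - t) - (1 - t) % N := hbN.trans (Int.dvd_self_sub_emod)
    have h4 : (b : ℤ) ∣ 1 := by
      have := dvd_add hd h3
      rwa [show (1 - t) % N + t + ((1 - t) - (1 - t) % N) = 1 by ring] at this
    have := Int.le_of_dvd one_pos h4
    have := hBpos b hb
    omega
  rw [← eta_eq_true, h1, indicatorSeq_eq_true] at h2
  exact h2

end Admissible

section Coprime

variable {B : Set ℕ}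

/-- By Dirichlet's theorem, every class modulo `k` contains integers with no small divisors other
than the unavoidable ones. -/
lemma exists_modEq_forall_dvd {k : ℕ} (hk : k ≠ 0) (s : ℤ) (M : ℕ) :
    ∃ n : ℤ, (k : ℤ) ∣ n - s ∧ ∀ c : ℕ, c ≠ 0 → c ≤ M → (c : ℤ) ∣ n → c ∣ k := by
  have hg : Int.gcd s k ≠ 0 := by
    rw [Ne, Int.gcd_eq_zero_iff]
    omega
  set g := Int.gcd s k with hgdef
  obtain ⟨s', hs'⟩ : (g : ℤ) ∣ s := Int.gcd_dvd_left ..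
  obtain ⟨k', hk'⟩ : g ∣ k := Int.natCast_dvd_natCast.1 (Int.gcd_dvd_right ..)
  have hcop : Int.gcd s' k' = 1 := by
    have : Int.gcd s k = g * Int.gcd s' k' := by
      rw [hs', hk', Nat.cast_mul, Int.gcd_mul_left, Int.natAbs_natCast]
    rw [← hgdef] at this
    exact Nat.eq_of_mul_eq_mul_left (Nat.pos_of_ne_zero hg) (by omega)
  have : NeZero k' := ⟨by rintro rfl; simp at hk'; exact hk hk'⟩
  have hu : IsUnit (s' : ZMod k') := by
    rw [ZMod.coe_int_isUnit_iff_isCoprime]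
    exact (Int.isCoprime_iff_gcd_eq_one.2 hcop).symm
  obtain ⟨p, hpM, hp, hps⟩ := Nat.forall_exists_prime_gt_and_eq_mod hu M
  refine ⟨g * p, ?_, fun c hc0 hcM hcd => ?_⟩
  · have h1 : (k' : ℤ) ∣ p - s' := by
      rw [← ZMod.intCast_zmod_eq_zero_iff_dvd]
      push_cast
      rw [hps, sub_self]
    rw [hs', hk', ← mul_sub, Nat.cast_mul]
    exact mul_dvd_mul_left _ h1
  · have h1 : c ∣ g * p := by exact_mod_cast hcd
    have h2 : Nat.Coprime c p := by
      rw [Nat.coprime_comm, hp.coprime_iff_not_dvd]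
      exact fun h => absurd (Nat.le_of_dvd (Nat.pos_of_ne_zero hc0) h) (by omega)
    exact (h2.dvd_of_dvd_mul_right h1).trans ⟨k', hk'⟩

/-- If an odd prime power divides `a` but not `b`, there is `v ≡ 1` modulo `b` but not modulo `a`
that is coprime to all small integers. -/
lemma exists_modEq_one_coprime {a b p k : ℕ} (hp : p.Prime) (hp2 : p ≠ 2) (ha : p ^ k ∣ a)
    (hb : ¬ p ^ k ∣ b) (M : ℕ) :
    ∃ v : ℕ, b ∣ v - 1 ∧ 1 ≤ v ∧ ¬ a ∣ v - 1 ∧ ∀ c : ℕ, c ≠ 0 → c ≤ M → Nat.Coprime c v := by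
  classical
  set P := ∏ q ∈ (Finset.range (M + 1)).filter (fun q => q.Prime ∧ q ≠ p), q with hP
  have hpP : Nat.Coprime p P := Nat.Coprime.prod_right fun q hq => by
    obtain ⟨-, hq, hqp⟩ := Finset.mem_filter.1 hq
    exact (Nat.coprime_primes hp hq).2 (Ne.symm hqp)
  obtain ⟨j, hj, hjv⟩ : ∃ j, Nat.Coprime p j ∧ ¬ p ∣ 1 + j * (b * P) := by
    by_cases h : p ∣ 1 + 1 * (b * P)
    · refine ⟨2, (Nat.coprime_primes hp Nat.prime_two).2 hp2, fun h2 => ?_⟩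
      have h3 : p ∣ b * P := by
        have := Nat.dvd_sub h2 h
        rwa [show 1 + 2 * (b * P) - (1 + 1 * (b * P)) = b * P by omega] at this
      have h4 := (Nat.dvd_add_left (h3.mul_left 1)).1 h
      exact hp.one_lt.ne' (Nat.dvd_one.1 h4)
    · exact ⟨1, Nat.coprime_one_right p, h⟩
  refine ⟨1 + j * (b * P), ?_, by omega, ?_, fun c hc0 hcM => ?_⟩
  · rw [Nat.add_sub_cancel_left]
    exact (Nat.dvd_mul_right b P).mul_left j
  · rw [Nat.add_sub_cancel_left]
    intro h
    have h1 : p ^ k ∣ b * (j * P) := by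
      have := ha.trans h
      rwa [show j * (b * P) = b * (j * P) by ring] at this
    exact hb (((hj.mul_right hpP).pow_left k).dvd_of_dvd_mul_right h1)
  · refine Nat.coprime_of_dvd fun q hq hqc hqv => ?_
    have hqM : q ≤ M := (Nat.le_of_dvd (Nat.pos_of_ne_zero hc0) hqc).trans hcM
    by_cases hqp : q = p
    · exact hjv (hqp ▸ hqv)
    · have h1 : q ∣ P := Finset.dvd_prod_of_mem (fun q => q)
        (Finset.mem_filter.2 ⟨Finset.mem_range.2 (by omega), hq, hqp⟩)
      have h2 := (Nat.dvd_add_left ((h1.mul_left b).mul_left j)).1 hqv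
      exact hq.one_lt.ne' (Nat.dvd_one.1 h2)

lemma coprime_of_odd_prime_pow_dvd (hBpos : ∀ b ∈ B, 2 ≤ b) (hBprim : Primitive B)
    (heq : Xeta B = XB B) {a b : ℕ} (ha : a ∈ B) (hb : b ∈ B) {p k : ℕ} (hp : p.Prime)
    (hp2 : p ≠ 2) (hpa : p ^ k ∣ a) (hpb : ¬ p ^ k ∣ b) : Nat.Coprime a b := by
  classical
  have ha2 := hBpos a ha
  have hb2 := hBpos b hb
  have h1 : ∀ s : ℤ, ∃ n : ℤ, (a : ℤ) ∣ n - s ∧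
      ∀ c ∈ B, c ≠ a → c ≤ a + b → ¬ (c : ℤ) ∣ n - 1 := by
    intro s
    obtain ⟨n, hn, hc⟩ := exists_modEq_forall_dvd (k := a) (by omega) (s - 1) (a + b)
    refine ⟨n + 1, by rwa [show n + 1 - s = n - (s - 1) by ring], fun c hcB hca hcM hd => ?_⟩
    have := hBpos c hcB
    exact hca (hBprim c hcB a ha (hc c (by omega) hcM (by rwa [add_sub_cancel_right] at hd)))
  have h2 : ∀ s : ℤ, ∃ n : ℤ, ¬ (b : ℤ) ∣ s - 1 → (b : ℤ) ∣ n - s ∧ ¬ (a : ℤ) ∣ n ∧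
      ∀ c ∈ B, c ≠ a → c ≤ a + b → ¬ (c : ℤ) ∣ n - 1 := by
    intro s
    by_cases hs : (b : ℤ) ∣ s - 1
    · exact ⟨0, fun h => absurd hs h⟩
    obtain ⟨n, hn, hc⟩ := exists_modEq_forall_dvd (k := b) (by omega) (s - 1) (a + b)
    have hnc : ∀ c ∈ B, c ≤ a + b → ¬ (c : ℤ) ∣ n := by
      intro c hcB hcM hd
      have := hBpos c hcB
      have hcb := hBprim c hcB b hb (hc c (by omega) hcM hd)
      subst hcb
      exact hs ((dvd_sub_right hd).1 hn)
    by_cases han : (a : ℤ) ∣ n + 1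
    · obtain ⟨v, hbv, hv1, hav, hcv⟩ := exists_modEq_one_coprime hp hp2 hpa hpb (a + b)
      have hbv' : (b : ℤ) ∣ v - 1 := by
        have := Int.natCast_dvd_natCast.2 hbv
        rwa [Nat.cast_sub hv1, Nat.cast_one] at this
      have hav' : ¬ (a : ℤ) ∣ v - 1 := by
        have := mt Int.natCast_dvd_natCast.1 hav
        rwa [Nat.cast_sub hv1, Nat.cast_one] at this
      refine ⟨n * v + 1, fun _ => ⟨?_, ?_, fun c hcB hca hcM hd => ?_⟩⟩
      · rw [show n * v + 1 - s = n * (v - 1) + (n - (s - 1)) by ring]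
        exact dvd_add (hbv'.mul_left _) hn
      · intro h
        apply hav'
        have := dvd_sub (han.mul_right (v : ℤ)) h
        rwa [show (n + 1) * (v : ℤ) - (n * v + 1) = v - 1 by ring] at this
      · rw [add_sub_cancel_right] at hd
        have := hBpos c hcB
        exact hnc c hcB hcM (IsCoprime.dvd_of_dvd_mul_right
          (Nat.isCoprime_iff_coprime.2 (hcv c (by omega) hcM)) hd)
    · exact ⟨n + 1, fun _ => ⟨by rwa [show n + 1 - s = n - (s - 1) by ring], han,
        fun c hcB _ hcM hd => hnc c hcB hcM (by rwa [add_sub_cancel_right] at hd)⟩⟩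
  choose f hfa hfc using h1
  choose g hg using h2
  set A : Finset ℤ := (Finset.Ico (1 : ℤ) a).image f ∪ (Finset.Ico (2 : ℤ) (b + 1)).image g with hA
  have hgs : ∀ s ∈ Finset.Ico (2 : ℤ) (b + 1), ¬ (b : ℤ) ∣ s - 1 := by
    intro s hs hd
    rw [Finset.mem_Ico] at hs
    have := Int.le_of_dvd (by omega) hd
    omega
  have hcard : A.card ≤ a + b := by
    refine (Finset.card_union_le _ _).trans (add_le_add ?_ ?_)
    · refine Finset.card_image_le.trans ?_
      rw [Int.card_Ico]
      omega
    · refine Finset.card_image_le.trans ?_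
      rw [Int.card_Ico]
      omega
  have hadm : IsBAdmissible B (A : Set ℤ) := by
    refine isBAdmissible_of_small A fun c hcB hcA => ?_
    by_cases hca : c = a
    · subst hca
      refine ⟨0, fun x hx => ?_⟩
      rw [sub_zero]
      rcases Finset.mem_union.1 hx with hx | hx
      · obtain ⟨s, hs, rfl⟩ := Finset.mem_image.1 hx
        intro hd
        have h := (dvd_sub_right hd).1 (hfa s)
        rw [Finset.mem_Ico] at hs
        have := Int.le_of_dvd (by omega) h
        omega
      · obtain ⟨s, hs, rfl⟩ := Finset.mem_image.1 hx
        exact (hg s (hgs s hs)).2.1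
    · refine ⟨1, fun x hx => ?_⟩
      rcases Finset.mem_union.1 hx with hx | hx
      · obtain ⟨s, hs, rfl⟩ := Finset.mem_image.1 hx
        exact hfc s c hcB hca (hcA.trans hcard)
      · obtain ⟨s, hs, rfl⟩ := Finset.mem_image.1 hx
        exact (hg s (hgs s hs)).2.2 c hcB hca (hcA.trans hcard)
  obtain ⟨t, ht⟩ := exists_eta_eq_of_mem_Xeta
    (show indicatorSeq (A : Set ℤ) ∈ Xeta B by rw [heq, indicatorSeq_mem_XB]; exact hadm) A
  have hfree : ∀ x ∈ A, x + t ∈ BFreeSet B := fun x hx => by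
    rw [← eta_eq_true, ht x hx, indicatorSeq_eq_true]
    exact hx
  have hat : (a : ℤ) ∣ t := by
    by_contra hcon
    have hne : (-t) % a ≠ 0 := fun h => hcon ((dvd_neg).1 (Int.dvd_of_emod_eq_zero h))
    have hnn := Int.emod_nonneg (-t) (b := a) (by omega)
    have hlt := Int.emod_lt_of_pos (-t) (b := a) (by omega)
    have hmem : f ((-t) % a) ∈ A := Finset.mem_union_left _
      (Finset.mem_image_of_mem _ (Finset.mem_Ico.2 ⟨by omega, hlt⟩))
    apply hfree _ hmem a ha
    have h3 : (a : ℤ) ∣ -t - (-t) % a := Int.dvd_self_sub_emod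
    have := dvd_sub (hfa ((-t) % a)) h3
    rwa [show f ((-t) % a) - (-t) % a - (-t - (-t) % a) = f ((-t) % a) + t by ring] at this
  have hbt : (b : ℤ) ∣ t + 1 := by
    by_contra hcon
    have hne : (-t - 1) % b ≠ 0 := fun h => hcon (by
      have := (dvd_neg).2 (Int.dvd_of_emod_eq_zero h)
      rwa [show -(-t - 1) = t + 1 by ring] at this)
    have hnn := Int.emod_nonneg (-t - 1) (b := b) (by omega)
    have hlt := Int.emod_lt_of_pos (-t - 1) (b := b) (by omega)
    have hmem' : (-t - 1) % b + 1 ∈ Finset.Ico (2 : ℤ) (b + 1) :=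
      Finset.mem_Ico.2 ⟨by omega, by omega⟩
    apply hfree _ (Finset.mem_union_right _ (Finset.mem_image_of_mem g hmem')) b hb
    have h3 : (b : ℤ) ∣ -t - 1 - (-t - 1) % b := Int.dvd_self_sub_emod
    have := dvd_sub (hg _ (hgs _ hmem')).1 h3
    rwa [show g ((-t - 1) % b + 1) - ((-t - 1) % b + 1) - (-t - 1 - (-t - 1) % b)
      = g ((-t - 1) % b + 1) + t by ring] at this
  rw [← Nat.isCoprime_iff_coprime]
  obtain ⟨u, hu⟩ := hat
  obtain ⟨w, hw⟩ := hbt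
  exact ⟨-u, w, by linear_combination hu - hw⟩

theorem coprime_of_Xeta_eq_XB (hBpos : ∀ b ∈ B, 2 ≤ b) (hBprim : Primitive B)
    (heq : Xeta B = XB B) {a b : ℕ} (ha : a ∈ B) (hb : b ∈ B) (hab : a ≠ b) :
    Nat.Coprime a b := by
  have h1 : ¬ a ∣ b := fun h => hab (hBprim a ha b hb h)
  have h2 : ¬ b ∣ a := fun h => hab (hBprim b hb a ha h).symm
  rw [Nat.dvd_iff_prime_pow_dvd_dvd] at h1 h2
  push Not at h1 h2
  obtain ⟨p, k, hp, hpa, hpb⟩ := h1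
  obtain ⟨q, l, hq, hqb, hqa⟩ := h2
  by_cases hp2 : p = 2
  · have hq2 : q ≠ 2 := by
      rintro rfl
      subst hp2
      rcases le_total k l with h | h
      · exact hpb ((pow_dvd_pow 2 h).trans hqb)
      · exact hqa ((pow_dvd_pow 2 h).trans hpa)
    exact (coprime_of_odd_prime_pow_dvd hBpos hBprim heq hb ha hq hq2 hqb hqa).symm
  · exact coprime_of_odd_prime_pow_dvd hBpos hBprim heq ha hb hp hp2 hpa hpb

end Coprime

section Construction

variable {B : Set ℕ}

lemma exists_crt (C : Finset ℕ) (hC : ∀ c ∈ C, c ≠ 0)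
    (hcop : (C : Set ℕ).Pairwise Nat.Coprime) :
    ∃ Q : ℤ, 0 < Q ∧ ∀ (ρ : ℕ → ℤ) (K : ℤ),
      ∃ n : ℤ, K ≤ n ∧ n < K + Q ∧ ∀ c ∈ C, (c : ℤ) ∣ n - ρ c := by
  have hQ : (0 : ℤ) < ∏ c ∈ C, (c : ℤ) := Finset.prod_pos fun c hc => by
    have := hC c hc
    omega
  refine ⟨∏ c ∈ C, (c : ℤ), hQ, fun ρ K => ?_⟩
  obtain ⟨m, hm⟩ := Nat.chineseRemainderOfFinset (fun c => (ρ c % c).toNat) id (t := C) hC hcop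
  refine ⟨K + (m - K) % ∏ c ∈ C, (c : ℤ), ?_, ?_, fun c hc => ?_⟩
  · have := Int.emod_nonneg ((m : ℤ) - K) hQ.ne'
    omega
  · have := Int.emod_lt_of_pos ((m : ℤ) - K) hQ
    omega
  · have hc0 := hC c hc
    have h1 : (c : ℤ) ∣ (m - K) - (m - K) % ∏ c ∈ C, (c : ℤ) :=
      (Finset.dvd_prod_of_mem (fun c : ℕ => (c : ℤ)) hc).trans Int.dvd_self_sub_emod
    have h2 : (c : ℤ) ∣ ρ c % c - m := by
      have := (Nat.modEq_iff_dvd.1 (hm c hc))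
      rwa [Int.toNat_of_nonneg (Int.emod_nonneg _ (by exact_mod_cast hc0))] at this
    have h3 : (c : ℤ) ∣ ρ c - ρ c % c := Int.dvd_self_sub_emod
    have := dvd_neg.2 (dvd_add (dvd_add h1 h2) h3)
    rwa [show -((m - K) - (m - K) % (∏ c ∈ C, (c : ℤ)) + (ρ c % c - m) + (ρ c - ρ c % c))
      = K + (m - K) % (∏ c ∈ C, (c : ℤ)) - ρ c by ring] at this

lemma exists_crt_le (hBpos : ∀ b ∈ B, 2 ≤ b) (hcop : B.Pairwise Nat.Coprime) (M : ℕ) :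
    ∃ Q : ℤ, 0 < Q ∧ ∀ (ρ : ℕ → ℤ) (K : ℤ),
      ∃ n : ℤ, K ≤ n ∧ n < K + Q ∧ ∀ c ∈ B, c ≤ M → (c : ℤ) ∣ n - ρ c := by
  classical
  obtain ⟨Q, hQ, h⟩ := exists_crt ((Finset.range (M + 1)).filter (· ∈ B))
    (fun c hc => by have := hBpos c (Finset.mem_filter.1 hc).2; omega)
    (hcop.mono fun c hc => (Finset.mem_filter.1 hc).2)
  refine ⟨Q, hQ, fun ρ K => ?_⟩
  obtain ⟨n, h1, h2, h3⟩ := h ρ K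
  exact ⟨n, h1, h2, fun c hc hcM =>
    h3 c (Finset.mem_filter.2 ⟨Finset.mem_range.2 (by omega), hc⟩)⟩

/-- If for each offset `t` there is an admissible pattern omitting `t`, then patterns can be placed
at positions covering every residue class of some `b ∈ B` without losing admissibility. -/
lemma exists_admissible_patterns (hBpos : ∀ b ∈ B, 2 ≤ b) (hinf : B.Infinite)
    (hcop : B.Pairwise Nat.Coprime) (l : ℕ) (W : ℤ → Finset ℤ)
    (hW : ∀ t, IsBAdmissible B (W t : Set ℤ)) (hWl : ∀ t, ∀ i ∈ W t, -(l : ℤ) ≤ i ∧ i ≤ l)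
    (hWt : ∀ t, t ∉ W t) :
    ∃ A : Finset ℤ, IsBAdmissible B (A : Set ℤ) ∧ ∃ b ∈ B, ∀ r : ℤ, ∃ m t : ℤ, (b : ℤ) ∣ m - r ∧
      ∀ i : ℤ, -(l : ℤ) ≤ i → i ≤ l → (m + i ∈ A ↔ i ∈ W t) := by
  classical
  obtain ⟨b, hb, hbl⟩ := hinf.exists_gt (2 * l + 1)
  set M := b * (2 * l + 1) with hM
  have hbM : b ≤ M := Nat.le_mul_of_pos_right b (by omega)
  have hρ : ∀ (t : ℤ) (c : ℕ), ∃ ρ : ℤ, c ∈ B → ∀ a ∈ W t, ¬ (c : ℤ) ∣ a - ρ := fun t c => by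
    by_cases hc : c ∈ B
    · obtain ⟨ρ, hρ⟩ := hW t c hc
      exact ⟨ρ, fun _ => hρ⟩
    · exact ⟨0, fun h => absurd h hc⟩
  choose ρ hρ using hρ
  have hT : ∀ r : ℕ, ∃ t : ℤ, ∀ s : ℤ, -(l : ℤ) ≤ s → s ≤ l → (b : ℤ) ∣ r + s → s = t := by
    intro r
    by_cases h : ∃ t : ℤ, -(l : ℤ) ≤ t ∧ t ≤ l ∧ (b : ℤ) ∣ r + t
    · obtain ⟨t, ht1, ht2, ht⟩ := h
      refine ⟨t, fun s hs1 hs2 hs => ?_⟩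
      have h1 := dvd_sub hs ht
      rw [add_sub_add_left_eq_sub] at h1
      have := Int.eq_zero_of_abs_lt_dvd h1 (by rw [abs_lt]; constructor <;> omega)
      omega
    · exact ⟨0, fun s hs1 hs2 hs => absurd ⟨s, hs1, hs2, hs⟩ h⟩
  choose T hT using hT
  obtain ⟨Q, hQ, hcrt⟩ := exists_crt_le hBpos hcop M
  have hn : ∀ r : ℕ, ∃ n : ℤ, r * (Q + 2 * l + 1) ≤ n ∧ n < r * (Q + 2 * l + 1) + Q ∧
      ∀ c ∈ B, c ≤ M → (c : ℤ) ∣ n - (if c = b then (r : ℤ) else -ρ (T r) c) :=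
    fun r => hcrt (fun c => if c = b then (r : ℤ) else -ρ (T r) c) _
  choose n hn1 hn2 hn using hn
  have hsep : ∀ r r' : ℕ, r < r' → n r + 2 * l < n r' := by
    intro r r' h
    have h1 : ((r : ℤ) + 1) * (Q + 2 * l + 1) ≤ r' * (Q + 2 * l + 1) :=
      mul_le_mul_of_nonneg_right (by omega) (by omega)
    have := hn2 r
    have := hn1 r'
    rw [add_mul, one_mul] at h1
    omega
  set A : Finset ℤ := (Finset.range b).biUnion fun r => (W (T r)).image (n r + ·) with hA
  have hcard : A.card ≤ M := by
    refine (Finset.card_biUnion_le_card_mul _ _ (2 * l + 1) fun r _ => ?_).trans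
      (by rw [Finset.card_range])
    refine Finset.card_image_le.trans ?_
    refine (Finset.card_le_card (t := Finset.Icc (-(l : ℤ)) l) fun i hi =>
      Finset.mem_Icc.2 (hWl _ i hi)).trans ?_
    rw [Int.card_Icc]
    omega
  refine ⟨A, isBAdmissible_of_small A fun c hc hcA => ?_, b, hb, fun r => ?_⟩
  · refine ⟨0, fun x hx hd => ?_⟩
    rw [sub_zero] at hd
    obtain ⟨r, -, hx⟩ := Finset.mem_biUnion.1 hx
    obtain ⟨w, hw, rfl⟩ := Finset.mem_image.1 hx
    have h1 := hn r c hc (hcA.trans hcard)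
    by_cases hcb : c = b
    · subst hcb
      rw [if_pos rfl] at h1
      have h2 := dvd_sub hd h1
      rw [show n r + w - (n r - r) = r + w by ring] at h2
      have h3 := hT r w (hWl _ w hw).1 (hWl _ w hw).2 h2
      exact hWt _ (h3 ▸ hw)
    · rw [if_neg hcb] at h1
      have h2 := dvd_sub hd h1
      rw [show n r + w - (n r - -ρ (T r) c) = w - ρ (T r) c by ring] at h2
      exact hρ _ _ hc w hw h2
  · have hb0 : (0 : ℤ) < b := by omega
    have hr0 := Int.emod_nonneg r hb0.ne'
    have hrb := Int.emod_lt_of_pos r hb0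
    obtain ⟨k, hk⟩ := Int.eq_ofNat_of_zero_le hr0
    refine ⟨n k, T k, ?_, fun i hi1 hi2 => ⟨fun h => ?_, fun h => ?_⟩⟩
    · have h1 := hn k b hb hbM
      rw [if_pos rfl, ← hk] at h1
      have h2 : (b : ℤ) ∣ r - r % b := Int.dvd_self_sub_emod
      have := dvd_sub h1 h2
      rwa [show n k - r % b - (r - r % b) = n k - r by ring] at this
    · obtain ⟨r', -, hx⟩ := Finset.mem_biUnion.1 h
      obtain ⟨w, hw, hwe⟩ := Finset.mem_image.1 hx
      have hwl := hWl _ w hw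
      rcases lt_trichotomy r' k with h' | h' | h'
      · have := hsep _ _ h'
        omega
      · subst h'
        obtain rfl : w = i := by omega
        exact hw
      · have := hsep _ _ h'
        omega
    · exact Finset.mem_biUnion.2 ⟨k, Finset.mem_range.2 (by omega),
        Finset.mem_image_of_mem _ h⟩

/-- An admissible finite set can be enlarged far to the right so that a given missing point can no
longer be added. -/
lemma exists_blocking_superset (hBpos : ∀ b ∈ B, 2 ≤ b) (hinf : B.Infinite)
    (hcop : B.Pairwise Nat.Coprime) (A : Finset ℤ) (hA : IsBAdmissible B (A : Set ℤ)) {i : ℤ}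
    (hi : i ∉ A) (K : ℤ) :
    ∃ A' : Finset ℤ, A ⊆ A' ∧ IsBAdmissible B (A' : Set ℤ) ∧ (∀ j ∈ A', j ∉ A → K < j) ∧
      ∀ D : Set ℤ, (A' : Set ℤ) ⊆ D → IsBAdmissible B D → i ∉ D := by
  classical
  obtain ⟨b, hb, hbl⟩ := hinf.exists_gt (∑ a ∈ A, (a - i).natAbs)
  have hbA : ∀ a ∈ A, ¬ (b : ℤ) ∣ a - i := by
    intro a ha hd
    have h1 : (a - i).natAbs ≤ ∑ a ∈ A, (a - i).natAbs :=
      Finset.single_le_sum (f := fun a : ℤ => (a - i).natAbs) (fun _ _ => Nat.zero_le _) ha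
    have := Int.eq_zero_of_abs_lt_dvd hd (by rw [Int.abs_eq_natAbs]; omega)
    obtain rfl : a = i := by omega
    exact hi ha
  have hb2 := hBpos b hb
  have hρ : ∀ c : ℕ, ∃ ρ : ℤ, c ∈ B → ∀ a ∈ A, ¬ (c : ℤ) ∣ a - ρ := fun c => by
    by_cases hc : c ∈ B
    · obtain ⟨ρ, hρ⟩ := hA c hc
      exact ⟨ρ, fun _ => hρ⟩
    · exact ⟨0, fun h => absurd h hc⟩
  choose ρ hρ using hρ
  obtain ⟨Q, hQ, hcrt⟩ := exists_crt_le hBpos hcop (A.card + b)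
  have hm : ∀ r : ℤ, ∃ m : ℤ, K + 1 ≤ m ∧ m < K + 1 + Q ∧
      ∀ c ∈ B, c ≤ A.card + b → (c : ℤ) ∣ m - (if c = b then r else ρ c + 1) :=
    fun r => hcrt (fun c => if c = b then r else ρ c + 1) _
  choose m hm1 hm2 hm using hm
  have hmb : ∀ r, (b : ℤ) ∣ m r - r := fun r => by
    have := hm r b hb (by omega)
    rwa [if_pos rfl] at this
  set A' : Finset ℤ := A ∪ ((Finset.Ico (0 : ℤ) b).filter fun r => ¬ (b : ℤ) ∣ r - i).image m
    with hA'
  have hcard : A'.card ≤ A.card + b := by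
    refine (Finset.card_union_le _ _).trans (add_le_add le_rfl ?_)
    refine Finset.card_image_le.trans ((Finset.card_filter_le _ _).trans ?_)
    rw [Int.card_Ico]
    omega
  refine ⟨A', Finset.subset_union_left, isBAdmissible_of_small A' fun c hc hcA => ?_,
    fun j hj hjA => ?_, fun D hD hDadm hiD => ?_⟩
  · by_cases hcb : c = b
    · subst hcb
      refine ⟨i, fun x hx hd => ?_⟩
      rcases Finset.mem_union.1 hx with hx | hx
      · exact hbA x hx hd
      · obtain ⟨r, hr, rfl⟩ := Finset.mem_image.1 hx
        have := dvd_sub hd (hmb r)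
        rw [sub_sub_sub_cancel_left] at this
        exact (Finset.mem_filter.1 hr).2 this
    · refine ⟨ρ c, fun x hx hd => ?_⟩
      rcases Finset.mem_union.1 hx with hx | hx
      · exact hρ c hc x hx hd
      · obtain ⟨r, hr, rfl⟩ := Finset.mem_image.1 hx
        have h1 := hm r c hc (hcA.trans hcard)
        rw [if_neg hcb] at h1
        have h2 := dvd_sub hd h1
        rw [show m r - ρ c - (m r - (ρ c + 1)) = 1 by ring] at h2
        have := Int.le_of_dvd one_pos h2
        have := hBpos c hc
        omega
  · rcases Finset.mem_union.1 hj with hj | hj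
    · exact absurd hj hjA
    · obtain ⟨r, hr, rfl⟩ := Finset.mem_image.1 hj
      have := hm1 r
      omega
  · obtain ⟨q, hq⟩ := hDadm b hb
    have hb0 : (0 : ℤ) < b := by omega
    have h1 : (b : ℤ) ∣ q - q % b := Int.dvd_self_sub_emod
    have hmem : q % b ∈ (Finset.Ico (0 : ℤ) b).filter fun r => ¬ (b : ℤ) ∣ r - i := by
      refine Finset.mem_filter.2 ⟨Finset.mem_Ico.2 ⟨Int.emod_nonneg _ hb0.ne',
        Int.emod_lt_of_pos _ hb0⟩, fun hd => hq i hiD ?_⟩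
      have := dvd_neg.2 (dvd_add h1 hd)
      rwa [show -(q - q % b + (q % b - i)) = i - q by ring] at this
    refine hq (m (q % b)) (hD (Finset.mem_union_right _ (Finset.mem_image_of_mem m hmem))) ?_
    have := dvd_sub (hmb (q % b)) h1
    rwa [show m (q % b) - q % b - (q - q % b) = m (q % b) - q by ring] at this

lemma exists_blocking_superset_finset (hBpos : ∀ b ∈ B, 2 ≤ b) (hinf : B.Infinite)
    (hcop : B.Pairwise Nat.Coprime) (A : Finset ℤ) (hA : IsBAdmissible B (A : Set ℤ)) (K : ℤ)
    (F : Finset ℤ) (hF : ∀ i ∈ F, i ∉ A ∧ i ≤ K) :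
    ∃ A' : Finset ℤ, A ⊆ A' ∧ IsBAdmissible B (A' : Set ℤ) ∧ (∀ j ∈ A', j ∉ A → K < j) ∧
      ∀ i ∈ F, ∀ D : Set ℤ, (A' : Set ℤ) ⊆ D → IsBAdmissible B D → i ∉ D := by
  classical
  induction F using Finset.induction_on with
  | empty => exact ⟨A, subset_rfl, hA, fun j hj hj' => absurd hj hj', by simp⟩
  | insert i F _ ih =>
    obtain ⟨A₁, h1, h2, h3, h4⟩ := ih fun j hj => hF j (Finset.mem_insert_of_mem hj)
    obtain ⟨hiA, hiK⟩ := hF i (Finset.mem_insert_self i F)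
    have hi : i ∉ A₁ := fun h => absurd (h3 i h hiA) (by omega)
    obtain ⟨A₂, k1, k2, k3, k4⟩ := exists_blocking_superset hBpos hinf hcop A₁ h2 hi K
    refine ⟨A₂, h1.trans k1, k2, fun j hj hjA => ?_, fun j hj D hD hDadm => ?_⟩
    · by_cases hj1 : j ∈ A₁
      · exact h3 j hj1 hjA
      · exact k3 j hj hj1
    · rcases Finset.mem_insert.1 hj with rfl | hj
      · exact k4 D hD hDadm
      · exact h4 j hj D ((Finset.coe_subset.2 k1).trans hD) hDadm

end Construction

section CellularAutomata

variable {B : Set ℕ} {τ : (ℤ → Bool) → (ℤ → Bool)}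

lemma IsCA.comm_shiftPow (hτ : IsCA (XB B) τ) (t : ℤ) :
    ∀ x ∈ XB B, τ (shiftPow t x) = shiftPow t (τ x) := by
  induction t using Int.induction_on with
  | zero => intro x _; rw [shiftPow_zero, shiftPow_zero]
  | succ n ih =>
    intro x hx
    rw [add_comm, ← shiftPow_shiftPow, ← shiftPow_shiftPow, ← ih x hx]
    exact hτ.2.2 _ (shiftPow_mem_XB hx _)
  | pred n ih =>
    intro x hx
    have h := hτ.2.2 _ (shiftPow_mem_XB hx (-(n : ℤ) - 1))
    have h1 : shift (shiftPow (-(n : ℤ) - 1) x) = shiftPow (-n) x := by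
      rw [shift, shiftPow_shiftPow]
      congr 1
      ring
    rw [h1, ih x hx] at h
    have h2 := congrArg (shiftPow (-1)) h
    rw [shift, shiftPow_shiftPow, shiftPow_shiftPow, neg_add_cancel, shiftPow_zero] at h2
    rw [← h2]
    congr 1
    ring

lemma IsCA.exists_hasRadius (hclosed : IsClosed (XB B)) (hτ : IsCA (XB B) τ) :
    ∃ l : ℕ, HasRadius (XB B) τ l := by
  classical
  have hloc : ∀ x ∈ XB B, ∃ U : Set (ℤ → Bool), ∃ F : Finset ℤ, U ∈ nhds x ∧
      ∀ y ∈ U, ∀ z, (∀ i ∈ F, z i = y i) → z ∈ XB B → τ z 0 = τ x 0 := by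
    intro x hx
    have hc : ContinuousWithinAt (fun y => τ y 0) (XB B) x :=
      (continuous_apply (0 : ℤ)).continuousAt.comp_continuousWithinAt (hτ.2.1 x hx)
    have h1 : {y | τ y 0 = τ x 0} ∈ nhdsWithin x (XB B) :=
      hc ((isOpen_discrete {τ x 0}).mem_nhds rfl)
    obtain ⟨V, hV, hxV, hVX⟩ := mem_nhdsWithin.1 h1
    obtain ⟨F, u, hu, huV⟩ := isOpen_pi_iff.1 hV x hxV
    refine ⟨(F : Set ℤ).pi u, F, (isOpen_set_pi F.finite_toSet fun i hi => (hu i hi).1).mem_nhds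
      fun i hi => (hu i hi).2, fun y hy z hz hzX => hVX ⟨huV fun i hi => ?_, hzX⟩⟩
    rw [hz i hi]
    exact hy i hi
  choose! U F hU hUF using hloc
  obtain ⟨s, hs, hsU⟩ := hclosed.isCompact.elim_nhds_subcover U hU
  refine ⟨∑ x ∈ s, ∑ i ∈ F x, i.natAbs, fun x hx y hy n hxy => ?_⟩
  have key : ∀ x ∈ XB B, ∀ y ∈ XB B,
      (∀ i : ℤ, i.natAbs ≤ ∑ x ∈ s, ∑ i ∈ F x, i.natAbs → x i = y i) → τ x 0 = τ y 0 := by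
    intro x hx y hy hxy
    obtain ⟨w, hw, hxw⟩ := Set.mem_iUnion₂.1 (hsU hx)
    rw [hUF w (hs w hw) x hxw x (fun _ _ => rfl) hx]
    refine (hUF w (hs w hw) x hxw y (fun i hi => (hxy i ?_).symm) hy).symm
    calc i.natAbs ≤ ∑ i ∈ F w, i.natAbs :=
          Finset.single_le_sum (f := fun i : ℤ => i.natAbs) (fun _ _ => Nat.zero_le _) hi
      _ ≤ _ := Finset.single_le_sum (f := fun x => ∑ i ∈ F x, i.natAbs)
          (fun _ _ => Nat.zero_le _) hw
  have h := key _ (shiftPow_mem_XB hx n) _ (shiftPow_mem_XB hy n)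
    fun i hi => hxy (i + n) (by omega) (by omega)
  rw [hτ.comm_shiftPow n x hx, hτ.comm_shiftPow n y hy] at h
  simpa only [shiftPow, zero_add] using h

theorem IsCA.exists_le_shiftPow (hBpos : ∀ b ∈ B, 2 ≤ b) (hinf : B.Infinite)
    (hcop : B.Pairwise Nat.Coprime) (hclosed : IsClosed (XB B)) (hτ : IsCA (XB B) τ) :
    ∃ t : ℤ, ∀ x ∈ XB B, ∀ n : ℤ, τ x n ≤ x (n + t) := by
  classical
  obtain ⟨l, hl⟩ := hτ.exists_hasRadius hclosed
  by_contra! hcon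
  choose x hx n hn using hcon
  have hτx : ∀ t, τ (x t) (n t) = true := fun t => (Bool.lt_iff.1 (hn t)).2
  have hxt : ∀ t, x t (n t + t) = false := fun t => (Bool.lt_iff.1 (hn t)).1
  set W : ℤ → Finset ℤ := fun t =>
    (Finset.Icc (-(l : ℤ)) l).filter fun i => shiftPow (n t) (x t) i = true with hW
  obtain ⟨A, hA, b, hb, h⟩ := exists_admissible_patterns hBpos hinf hcop l W
    (fun t => IsBAdmissible.mono (shiftPow_mem_XB (hx t) (n t))
      fun i hi => (Finset.mem_filter.1 hi).2)
    (fun t i hi => Finset.mem_Icc.1 (Finset.mem_filter.1 hi).1)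
    (fun t ht => by
      have := (Finset.mem_filter.1 ht).2
      rw [shiftPow, add_comm, hxt] at this
      exact Bool.false_ne_true this)
  have hAX : indicatorSeq (A : Set ℤ) ∈ XB B := indicatorSeq_mem_XB.2 hA
  obtain ⟨r, hr⟩ := hτ.1 hAX b hb
  obtain ⟨m, t, hm, hmt⟩ := h r
  refine hr m ?_ hm
  have h1 := hl _ (shiftPow_mem_XB hAX m) _ (shiftPow_mem_XB (hx t) (n t)) 0 fun i hi1 hi2 => by
    rw [Bool.eq_iff_iff]
    have h2 := hmt i (by omega) (by omega)
    rw [shiftPow, indicatorSeq_eq_true, Finset.mem_coe, add_comm, h2, hW, Finset.mem_filter]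
    exact ⟨fun h => h.2, fun h => ⟨Finset.mem_Icc.2 ⟨by omega, by omega⟩, h⟩⟩
  rw [hτ.comm_shiftPow _ _ hAX, hτ.comm_shiftPow _ _ (hx t), shiftPow, shiftPow, zero_add,
    zero_add, hτx] at h1
  exact h1

lemma IsCA.shiftPow_comp (hτ : IsCA (XB B) τ) (t : ℤ) :
    IsCA (XB B) (fun x => shiftPow t (τ x)) := by
  refine ⟨fun x hx => shiftPow_mem_XB (hτ.1 hx) t, ?_, fun x hx => ?_⟩
  · have : Continuous (shiftPow t) := continuous_pi fun n => continuous_apply (n + t)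
    exact this.comp_continuousOn hτ.2.1
  · change shiftPow t (τ (shift x)) = shift (shiftPow t (τ x))
    rw [hτ.2.2 x hx, shift, shiftPow_shiftPow, shiftPow_shiftPow, add_comm]

/-- The finite truncation of a point to the window of radius `l` around `n`. -/
lemma exists_finset_window {x : ℤ → Bool} (hx : x ∈ XB B) (l : ℕ) (n : ℤ) :
    ∃ A : Finset ℤ, IsBAdmissible B (A : Set ℤ) ∧ (∀ i ∈ A, i ≤ n + l) ∧
      ∀ i, n - l ≤ i → i ≤ n + l → (i ∈ A ↔ x i = true) := by
  classical
  refine ⟨(Finset.Icc (n - l) (n + l)).filter fun i => x i = true,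
    IsBAdmissible.mono hx fun i hi => (Finset.mem_filter.1 hi).2,
    fun i hi => (Finset.mem_Icc.1 (Finset.mem_filter.1 hi).1).2, fun i h1 h2 => ?_⟩
  rw [Finset.mem_filter, Finset.mem_Icc]
  exact ⟨fun h => h.2, fun h => ⟨⟨h1, h2⟩, h⟩⟩

theorem eqOn_id_of_surjOn (hBpos : ∀ b ∈ B, 2 ≤ b) (hinf : B.Infinite)
    (hcop : B.Pairwise Nat.Coprime) {l : ℕ} (hl : HasRadius (XB B) τ l)
    (hle : ∀ x ∈ XB B, ∀ n, τ x n ≤ x n) (hsurj : SurjOn τ (XB B) (XB B)) :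
    EqOn τ id (XB B) := by
  classical
  intro x hx
  funext n
  obtain ⟨A, hA, hAl, hAx⟩ := exists_finset_window hx l n
  obtain ⟨A', h1, h2, h3, h4⟩ := exists_blocking_superset_finset hBpos hinf hcop A hA (n + l)
    ((Finset.Icc (n - l) (n + l)).filter (· ∉ A))
    (fun i hi => ⟨(Finset.mem_filter.1 hi).2, (Finset.mem_Icc.1 (Finset.mem_filter.1 hi).1).2⟩)
  have hA'X : indicatorSeq (A' : Set ℤ) ∈ XB B := indicatorSeq_mem_XB.2 h2
  obtain ⟨y, hy, hyA⟩ := hsurj hA'X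
  have hsub : (A' : Set ℤ) ⊆ supp y := fun i hi => by
    have := hle y hy i
    rw [hyA, indicatorSeq_eq_true.2 hi] at this
    exact top_le_iff.1 this
  have hyx : ∀ i, n - l ≤ i → i ≤ n + l → y i = x i := by
    intro i hi1 hi2
    rw [Bool.eq_iff_iff, ← hAx i hi1 hi2]
    refine ⟨fun h => ?_, fun h => hsub (h1 h)⟩
    by_contra hiA
    exact h4 i (Finset.mem_filter.2 ⟨Finset.mem_Icc.2 ⟨hi1, hi2⟩, hiA⟩) _ hsub hy h
  rw [← hl y hy x hx n hyx, hyA, id, Bool.eq_iff_iff, indicatorSeq_eq_true,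
    ← hAx n (by omega) (by omega)]
  refine ⟨fun h => ?_, fun h => h1 h⟩
  by_contra hnA
  have := h3 n h hnA
  omega

theorem eqOn_id_of_preInjective {l : ℕ} (hl : HasRadius (XB B) τ l)
    (hle : ∀ x ∈ XB B, ∀ n, τ x n ≤ x n) (hinj : PreInjective (XB B) τ) : EqOn τ id (XB B) := by
  classical
  have hfin : ∀ A : Finset ℤ, IsBAdmissible B (A : Set ℤ) →
      τ (indicatorSeq A) = indicatorSeq A := by
    intro A
    induction A using Finset.strongInduction with
    | H A ih =>
      intro hA
      have hAX : indicatorSeq (A : Set ℤ) ∈ XB B := indicatorSeq_mem_XB.2 hA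
      set D : Finset ℤ := A.filter fun i => τ (indicatorSeq A) i = true with hD
      have hτD : τ (indicatorSeq A) = indicatorSeq D := by
        funext i
        rw [Bool.eq_iff_iff, indicatorSeq_eq_true, Finset.mem_coe, hD, Finset.mem_filter]
        refine ⟨fun h => ⟨?_, h⟩, fun h => h.2⟩
        have := hle _ hAX i
        rw [h] at this
        exact indicatorSeq_eq_true.1 (top_le_iff.1 this)
      have hDA : D ⊆ A := Finset.filter_subset _ A
      rcases hDA.eq_or_ssubset with h | h
      · rw [hτD, h]
      · have hDadm : IsBAdmissible B (D : Set ℤ) := hA.mono (Finset.coe_subset.2 h.subset)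
        have h1 := hinj _ hAX _ (indicatorSeq_mem_XB.2 hDadm) (by rw [hτD, ih D h hDadm])
          (A.finite_toSet.subset fun i hi => by
            by_contra hiA
            apply hi
            rw [Bool.eq_iff_iff, indicatorSeq_eq_true, indicatorSeq_eq_true]
            exact ⟨fun h => absurd h hiA, fun h' => absurd (h.subset h') hiA⟩)
        rw [hτD, ← h1]
  intro x hx
  funext n
  obtain ⟨A, hA, -, hAx⟩ := exists_finset_window hx l n
  have hAx' : ∀ i, n - l ≤ i → i ≤ n + l → x i = indicatorSeq (A : Set ℤ) i := fun i h1 h2 => by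
    rw [Bool.eq_iff_iff, indicatorSeq_eq_true]
    exact (hAx i h1 h2).symm
  rw [hl x hx _ (indicatorSeq_mem_XB.2 hA) n hAx', hfin A hA, id, hAx' n (by omega) (by omega)]

end CellularAutomata

/-- if `X_η = X_B`, then `(X_η, S)` satisfies the Garden of Eden theorem;
moreover every CA is dominated by a power of the shift, and every surjective CA is a power
of the shift. -/
theorem goe_of_eq_admissible (B : Set ℕ)
    (hBpos : ∀ b ∈ B, 2 ≤ b) (hBprim : Primitive B)
    (heq : Xeta B = XB B) :
    (∀ τ : (ℤ → Bool) → (ℤ → Bool), IsCA (Xeta B) τ →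
      (Set.SurjOn τ (Xeta B) (Xeta B) ↔ PreInjective (Xeta B) τ)) ∧
    (∀ τ : (ℤ → Bool) → (ℤ → Bool), IsCA (Xeta B) τ →
      ∃ t : ℤ, ∀ x ∈ Xeta B, ∀ n : ℤ, τ x n ≤ x (n + t)) ∧
    (∀ τ : (ℤ → Bool) → (ℤ → Bool), IsCA (Xeta B) τ →
      Set.SurjOn τ (Xeta B) (Xeta B) → ∃ t : ℤ, Set.EqOn τ (shiftPow t) (Xeta B)) := by
  have hinf := infinite_of_Xeta_eq_XB hBpos heq
  have hcop : B.Pairwise Nat.Coprime := fun a ha b hb hab =>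
    coprime_of_Xeta_eq_XB hBpos hBprim heq ha hb hab
  have hclosed : IsClosed (XB B) := heq ▸ isClosed_closure
  rw [heq]
  have hdom : ∀ τ, IsCA (XB B) τ → ∃ t : ℤ, ∀ x ∈ XB B, ∀ n : ℤ, τ x n ≤ x (n + t) :=
    fun τ hτ => hτ.exists_le_shiftPow hBpos hinf hcop hclosed
  have hreduce : ∀ τ, IsCA (XB B) τ → SurjOn τ (XB B) (XB B) ∨ PreInjective (XB B) τ →
      ∃ t : ℤ, EqOn τ (shiftPow t) (XB B) := by
    intro τ hτ h
    obtain ⟨t, ht⟩ := hdom τ hτ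
    have hσ := hτ.shiftPow_comp (-t)
    have hle : ∀ x ∈ XB B, ∀ n, shiftPow (-t) (τ x) n ≤ x n := fun x hx n => by
      have := ht x hx (n + -t)
      rwa [neg_add_cancel_right] at this
    have hback : ∀ x, shiftPow t (shiftPow (-t) x) = x := fun x => by
      rw [shiftPow_shiftPow, add_neg_cancel, shiftPow_zero]
    have hforth : ∀ x, shiftPow (-t) (shiftPow t x) = x := fun x => by
      rw [shiftPow_shiftPow, neg_add_cancel, shiftPow_zero]
    obtain ⟨l, hl⟩ := hσ.exists_hasRadius hclosed
    have hid : EqOn (fun x => shiftPow (-t) (τ x)) id (XB B) := by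
      rcases h with h | h
      · refine eqOn_id_of_surjOn hBpos hinf hcop hl hle fun y hy => ?_
        obtain ⟨x, hx, hxy⟩ := h (shiftPow_mem_XB hy t)
        exact ⟨x, hx, by simp only [hxy, hforth]⟩
      · refine eqOn_id_of_preInjective hl hle fun x hx y hy hxy hfin =>
          h x hx y hy ?_ hfin
        have := congrArg (shiftPow t) hxy
        simpa only [hback] using this
    refine ⟨t, fun x hx => ?_⟩
    have h1 : shiftPow (-t) (τ x) = x := hid hx
    rw [← hback (τ x), h1]
  refine ⟨fun τ hτ => ⟨fun h => ?_, fun h => ?_⟩, hdom, fun τ hτ h => hreduce τ hτ (Or.inl h)⟩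
  · obtain ⟨t, ht⟩ := hreduce τ hτ (Or.inl h)
    intro x hx y hy hxy _
    rw [ht hx, ht hy] at hxy
    have := congrArg (shiftPow (-t)) hxy
    rwa [shiftPow_shiftPow, shiftPow_shiftPow, neg_add_cancel, shiftPow_zero, shiftPow_zero]
      at this
  · obtain ⟨t, ht⟩ := hreduce τ hτ (Or.inr h)
    intro y hy
    refine ⟨shiftPow (-t) y, shiftPow_mem_XB hy _, ?_⟩
    rw [ht (shiftPow_mem_XB hy _), shiftPow_shiftPow, add_neg_cancel, shiftPow_zero]
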